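/- Let S, T be RCCS terms with at most one free variable X, and let =◇^p be the diamond equivalence for the testing context 𝒟 = D(P_RCCS). (1) If δ_{S{P/X}} =◇^p δ_{T{P/X}} for every process P ∈ P_RCCS, then δ_{μX.τ.S} =◇^p δ_{μX.τ.T}. (2) δ_{μX.T} =◇^p δ_{μX.τ.T}. -/

import Mathlib

open scoped Classical

/-! ## Channels, actions, RCCS terms -/

/-- Channels, drawn from an infinite set. -/
abbrev Chan := ℕ

/-- Actions: input/output labels over channels, the silent action `τ`, and the
distinguished success action `ω` (used only by observers). -/
inductive Act where
  | inp : Chan → Act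
  | out : Chan → Act
  | tau : Act
  | omega : Act
deriving DecidableEq

/-- `α` is an external label, i.e. a member of `𝓛 = N ∪ N̄`. -/
def Act.IsLabel : Act → Prop
  | .inp _ => True
  | .out _ => True
  | _ => False

/-- Complementary labels (for communication). -/
def Act.Comp : Act → Act → Prop := fun x y =>
  ∃ a, (x = .inp a ∧ y = .out a) ∨ (x = .out a ∧ y = .inp a)

/-- `β, β̄ ∉ L`: the action is not blocked by the localization `(L)-`. -/
def Act.Allowed (L : Finset Chan) : Act → Prop
  | .inp a => a ∉ L
  | .out a => a ∉ L
  | _ => True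

/-- Channels occurring in an action. -/
def Act.chans : Act → Finset Chan
  | .inp a => {a}
  | .out a => {a}
  | _ => ∅

/-- RCCS (and RCCS^ω) terms, with de Bruijn indices for process variables.
`sum k acts conts` is the nondeterministic choice `Σ_{i∈I} α_i.T_i` over the
nonempty finite index set `I = Fin (k+1)`, and `oplus k w conts` is the
probabilistic choice `⊕_{i∈I} p_i τ.T_i`. `fix T` is `μX.T` (binding index 0). -/
inductive Tm where
  | nil : Tm
  | var : ℕ → Tm
  | sum : (k : ℕ) → (Fin (k+1) → Act) → (Fin (k+1) → Tm) → Tm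
  | oplus : (k : ℕ) → (Fin (k+1) → ℝ) → (Fin (k+1) → Tm) → Tm
  | par : Tm → Tm → Tm
  | loc : Finset Chan → Tm → Tm
  | fix : Tm → Tm

/-- Substitution `T{P/X}` of a (closed) term `P` for the de Bruijn variable `n`. -/
def Tm.subst (P : Tm) : ℕ → Tm → Tm
  | _, .nil => .nil
  | n, .var m => if m = n then P else .var m
  | n, .sum k a c => .sum k a (fun i => Tm.subst P n (c i))
  | n, .oplus k w c => .oplus k w (fun i => Tm.subst P n (c i))
  | n, .par S T => .par (Tm.subst P n S) (Tm.subst P n T)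
  | n, .loc L T => .loc L (Tm.subst P n T)
  | n, .fix T => .fix (Tm.subst P (n+1) T)

/-- `T` has all its free variables among the first `n` de Bruijn indices.
`ClosedAt 0 T` means `T` is closed; `ClosedAt 1 T` means at most one free variable. -/
def Tm.ClosedAt : ℕ → Tm → Prop
  | _, .nil => True
  | n, .var m => m < n
  | n, .sum _ _ c => ∀ i, Tm.ClosedAt n (c i)
  | n, .oplus _ _ c => ∀ i, Tm.ClosedAt n (c i)
  | n, .par S T => Tm.ClosedAt n S ∧ Tm.ClosedAt n T
  | n, .loc _ T => Tm.ClosedAt n T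
  | n, .fix T => Tm.ClosedAt (n+1) T

/-- The success action `ω` does not occur in `T` (so `T` is a genuine RCCS term). -/
def Tm.NoOmega : Tm → Prop
  | .nil => True
  | .var _ => True
  | .sum _ a c => (∀ i, a i ≠ Act.omega) ∧ (∀ i, Tm.NoOmega (c i))
  | .oplus _ _ c => ∀ i, Tm.NoOmega (c i)
  | .par S T => Tm.NoOmega S ∧ Tm.NoOmega T
  | .loc _ T => Tm.NoOmega T
  | .fix T => Tm.NoOmega T

/-- No probabilistic choice occurs in `T` (so `T` is a CCS term). -/
def Tm.NoOplus : Tm → Prop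
  | .nil => True
  | .var _ => True
  | .sum _ _ c => ∀ i, Tm.NoOplus (c i)
  | .oplus _ _ _ => False
  | .par S T => Tm.NoOplus S ∧ Tm.NoOplus T
  | .loc _ T => Tm.NoOplus T
  | .fix T => Tm.NoOplus T

/-- The channels `N(T)` occurring in a term. -/
def Tm.chans : Tm → Finset Chan
  | .nil => ∅
  | .var _ => ∅
  | .sum _ a c =>
      (Finset.univ.sup fun i => (a i).chans) ∪ (Finset.univ.sup fun i => Tm.chans (c i))
  | .oplus _ _ c => Finset.univ.sup fun i => Tm.chans (c i)
  | .par S T => S.chans ∪ T.chans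
  | .loc L T => L ∪ T.chans
  | .fix T => T.chans

/-- Renaming of channels in an action. -/
def Act.rename (f : Chan → Chan) : Act → Act
  | .inp a => .inp (f a)
  | .out a => .out (f a)
  | x => x

/-- Renaming `T[f]` of the global channels of a term (local channels are untouched). -/
def Tm.rename : (Chan → Chan) → Tm → Tm
  | _, .nil => .nil
  | _, .var m => .var m
  | f, .sum k a c => .sum k (fun i => (a i).rename f) (fun i => Tm.rename f (c i))
  | f, .oplus k w c => .oplus k w (fun i => Tm.rename f (c i))
  | f, .par S T => .par (Tm.rename f S) (Tm.rename f T)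
  | f, .loc L T => .loc L (Tm.rename (fun a => if a ∈ L then a else f a) T)
  | f, .fix T => .fix (Tm.rename f T)

/-- `P` is an RCCS process: closed and without the success action. -/
def Tm.IsProc (P : Tm) : Prop := Tm.ClosedAt 0 P ∧ Tm.NoOmega P

/-- `P` is a CCS process: a process without probabilistic choice. -/
def Tm.IsCCS (P : Tm) : Prop := P.IsProc ∧ Tm.NoOplus P

/-! ## Finitely supported distributions -/

/-- Finitely supported probability distributions on `α`. -/
structure FinDist (α : Type) where
  toFun : α → ℝ
  nonneg : ∀ a, 0 ≤ toFun a
  finite_support : (Function.support toFun).Finite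
  sum_one : ∑ᶠ a, toFun a = 1

namespace FinDist

/-- The probability `μ(φ)` that a predicate (set) `φ` holds under `μ`. -/
noncomputable def mass {α : Type} (μ : FinDist α) (φ : Set α) : ℝ :=
  ∑ᶠ a ∈ φ, μ.toFun a

/-- The Dirac distribution `δ_P`. -/
noncomputable def dirac {α : Type} (P : α) : FinDist α where
  toFun := fun Q => if Q = P then 1 else 0
  nonneg := by intro a; by_cases h : a = P <;> simp [h]
  finite_support := by
    apply Set.Finite.subset (Set.finite_singleton P)
    intro a ha
    by_contra h
    simp only [Set.mem_singleton_iff] at h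
    simp [Function.mem_support, h] at ha
  sum_one := by
    rw [finsum_eq_single _ P (fun b hb => by simp [hb])]
    simp

/-- Pushforward of a finitely supported distribution along a map. -/
noncomputable def map {α β : Type} (g : α → β) (μ : FinDist α) : FinDist β where
  toFun := fun b => ∑ᶠ a ∈ {a | g a = b}, μ.toFun a
  nonneg := by
    intro b
    exact finsum_nonneg fun a => finsum_nonneg fun _ => μ.nonneg a
  finite_support := by
    apply Set.Finite.subset (μ.finite_support.image g)
    intro b hb
    rw [Function.mem_support] at hb
    by_contra h
    apply hb
    apply finsum_mem_eq_zero_of_forall_eq_zero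
    intro a ha
    by_contra ha0
    exact h ⟨a, Function.mem_support.mpr ha0, ha⟩
  sum_one := by
    classical
    set s := μ.finite_support.toFinset with hs
    have hfib : ∀ b : β, (∑ᶠ a ∈ {a | g a = b}, μ.toFun a)
        = ∑ a ∈ s.filter (fun a => g a = b), μ.toFun a := by
      intro b
      apply finsum_mem_eq_sum_of_inter_support_eq
      ext a
      simp only [Set.mem_inter_iff, Set.mem_setOf_eq, Finset.coe_filter,
        Set.Finite.mem_toFinset, Function.mem_support, hs]
      tauto
    have hsub : Function.support (fun b : β => ∑ᶠ a ∈ {a | g a = b}, μ.toFun a) ⊆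
        ↑(s.image g) := by
      intro b hb
      rw [Function.mem_support, hfib] at hb
      obtain ⟨a, ha, hne⟩ := Finset.exists_ne_zero_of_sum_ne_zero hb
      rw [Finset.mem_filter] at ha
      simp only [Finset.coe_image, Set.mem_image, Finset.mem_coe]
      exact ⟨a, ha.1, ha.2⟩
    rw [finsum_eq_finset_sum_of_support_subset _ hsub]
    calc ∑ b ∈ s.image g, ∑ᶠ a ∈ {a | g a = b}, μ.toFun a
        = ∑ b ∈ s.image g, ∑ a ∈ s.filter (fun a => g a = b), μ.toFun a :=
          Finset.sum_congr rfl fun b _ => hfib b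
      _ = ∑ a ∈ s, μ.toFun a :=
          Finset.sum_fiberwise_of_maps_to (fun a ha => Finset.mem_image_of_mem g ha)
            μ.toFun
      _ = 1 := by rw [← finsum_eq_sum μ.toFun μ.finite_support]; exact μ.sum_one

/-- The product of two finitely supported distributions. -/
noncomputable def prod {α β : Type} (μ : FinDist α) (ν : FinDist β) :
    FinDist (α × β) where
  toFun := fun x => μ.toFun x.1 * ν.toFun x.2
  nonneg := fun x => mul_nonneg (μ.nonneg _) (ν.nonneg _)
  finite_support := by
    apply Set.Finite.subset (μ.finite_support.prod ν.finite_support)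
    intro x hx
    rw [Function.mem_support] at hx
    have h := mul_ne_zero_iff.mp hx
    exact ⟨Function.mem_support.mpr h.1, Function.mem_support.mpr h.2⟩
  sum_one := by
    classical
    have hsub : Function.support (fun x : α × β => μ.toFun x.1 * ν.toFun x.2) ⊆
        ↑(μ.finite_support.toFinset ×ˢ ν.finite_support.toFinset) := by
      intro x hx
      rw [Function.mem_support] at hx
      have h := mul_ne_zero_iff.mp hx
      simp only [Finset.coe_product, Set.mem_prod, Set.Finite.coe_toFinset]
      exact ⟨h.1, h.2⟩
    rw [finsum_eq_finset_sum_of_support_subset _ hsub, Finset.sum_product]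
    have h1 : ∑ a ∈ μ.finite_support.toFinset, μ.toFun a = 1 := by
      rw [← finsum_eq_sum μ.toFun μ.finite_support]; exact μ.sum_one
    have h2 : ∑ b ∈ ν.finite_support.toFinset, ν.toFun b = 1 := by
      rw [← finsum_eq_sum ν.toFun ν.finite_support]; exact ν.sum_one
    calc ∑ a ∈ μ.finite_support.toFinset, ∑ b ∈ ν.finite_support.toFinset,
          μ.toFun a * ν.toFun b
        = ∑ a ∈ μ.finite_support.toFinset, μ.toFun a * 1 := by
          refine Finset.sum_congr rfl fun a _ => ?_
          rw [← Finset.mul_sum, h2]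
      _ = 1 := by simpa using h1

/-- Parallel composition `μ | ν` of distributions:
`(μ|ν)(A|B) = μ(A)·ν(B)`. -/
noncomputable def parD (μ ν : FinDist Tm) : FinDist Tm :=
  (μ.prod ν).map fun x => Tm.par x.1 x.2

/-- Localization `(L)μ` of a distribution. -/
noncomputable def locD (L : Finset Chan) (μ : FinDist Tm) : FinDist Tm :=
  μ.map (Tm.loc L)

/-- Renaming `μ[f]` of a distribution. -/
noncomputable def renameD (f : Chan → Chan) (μ : FinDist Tm) : FinDist Tm :=
  μ.map (Tm.rename f)

/-- Instantiation `ϑ[P]` of a 1-ary distribution `ϑ` at the process `P`. -/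
noncomputable def instD (ϑ : FinDist Tm) (P : Tm) : FinDist Tm :=
  ϑ.map (fun T => Tm.subst P 0 T)

/-- Every element of the support is a process (`μ ∈ D(P_RCCS)`). -/
def IsProcDist (μ : FinDist Tm) : Prop := ∀ P, μ.toFun P ≠ 0 → P.IsProc

/-- All channels occurring in (the support of) `μ` lie in `L`. -/
def chansIn (μ : FinDist Tm) (L : Finset Chan) : Prop :=
  ∀ P, μ.toFun P ≠ 0 → P.chans ⊆ L

/-- The channel `a` occurs in (the support of) `μ`, i.e. `a ∈ N(μ)`. -/
def hasChan (μ : FinDist Tm) (a : Chan) : Prop := ∃ P, μ.toFun P ≠ 0 ∧ a ∈ P.chans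

end FinDist

/-! ## Part I: the probabilistic labelled transition system on processes -/

/-- Part I of the pLTS for RCCS (and RCCS^ω): `P →α ρ`. -/
inductive Step : Tm → Act → FinDist Tm → Prop where
  | choice {k : ℕ} (acts : Fin (k+1) → Act) (conts : Fin (k+1) → Tm) (i : Fin (k+1)) :
      Step (.sum k acts conts) (acts i) (FinDist.dirac (conts i))
  | oplus {k : ℕ} (w : Fin (k+1) → ℝ) (conts : Fin (k+1) → Tm) (ρ : FinDist Tm) :
      (∀ i, 0 < w i ∧ w i < 1) →
      (∀ Q, ρ.toFun Q = ∑ i, if conts i = Q then w i else 0) →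
      Step (.oplus k w conts) .tau ρ
  | parL {S : Tm} {α : Act} {ρ : FinDist Tm} (T : Tm) :
      Step S α ρ → Step (.par S T) α (ρ.parD (FinDist.dirac T))
  | parR {T : Tm} {α : Act} {ρ : FinDist Tm} (S : Tm) :
      Step T α ρ → Step (.par S T) α ((FinDist.dirac S).parD ρ)
  | comm {S T : Tm} {ℓ1 ℓ2 : Act} {ρ1 ρ2 : FinDist Tm} :
      Act.Comp ℓ1 ℓ2 → Step S ℓ1 ρ1 → Step T ℓ2 ρ2 →
      Step (.par S T) .tau (ρ1.parD ρ2)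
  | loc {T : Tm} {β : Act} {ρ : FinDist Tm} (L : Finset Chan) :
      Step T β ρ → Act.Allowed L β → Step (.loc L T) β (FinDist.locD L ρ)
  | fixp {T : Tm} {β : Act} {ρ : FinDist Tm} :
      Step (Tm.subst (.fix T) 0 T) β ρ → Step (.fix T) β ρ

/-! ## Part II: probabilistic transitions on distributions -/

/-- Part II of the pLTS: `μ →(α,p) ν` iff `0 < p ≤ 1` and there are `P ∈ supp μ`
and `ρ` with `P →α ρ` and `ν = μ + μ(P)·p·(ρ − δ_P)`. -/
def PStep (μ : FinDist Tm) (α : Act) (p : ℝ) (ν : FinDist Tm) : Prop :=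
  0 < p ∧ p ≤ 1 ∧
    ∃ P ρ, 0 < μ.toFun P ∧ Step P α ρ ∧
      ∀ Q, ν.toFun Q = μ.toFun Q + μ.toFun P * p * (ρ.toFun Q - (if Q = P then 1 else 0))

/-- Probabilistic transition sequence `μ →π ν` along a word `π`. -/
def PSeq : FinDist Tm → List (Act × ℝ) → FinDist Tm → Prop
  | μ, [], ν => ν = μ
  | μ, s :: π, ν => ∃ μ', PStep μ s.1 s.2 μ' ∧ PSeq μ' π ν

/-- Internal transition sequence `μ ⇝ ν`. -/
def Internal (μ ν : FinDist Tm) : Prop :=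
  ∃ π : List (Act × ℝ), (∀ s ∈ π, s.1 = Act.tau) ∧ PSeq μ π ν

/-! ## Observability predicates and testing characteristics -/

/-- `ψ_𝓛`: processes that can immediately perform an external action. -/
def psiL : Set Tm := {P | ∃ α ρ, Act.IsLabel α ∧ Step P α ρ}

/-- `ψ_ω`: processes that can immediately perform the success action `ω`. -/
def psiOmega : Set Tm := {P | ∃ ρ, Step P Act.omega ρ}

/-- The may characteristic `χmay_𝓛(μ) = sup { ν(ψ_𝓛) : μ ⇝ ν }`. -/
noncomputable def chiMayL (μ : FinDist Tm) : ℝ :=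
  sSup {x | ∃ ν, Internal μ ν ∧ x = ν.mass psiL}

/-- The fair characteristic `χfair_𝓛(μ) = inf { χmay_𝓛(ν) : μ ⇝ ν }`. -/
noncomputable def chiFairL (μ : FinDist Tm) : ℝ :=
  sInf {x | ∃ ν, Internal μ ν ∧ x = chiMayL ν}

/-- `χmay_ω(μ) = sup { ν(ψ_ω) : μ ⇝ ν }`. -/
noncomputable def chiMayOmega (μ : FinDist Tm) : ℝ :=
  sSup {x | ∃ ν, Internal μ ν ∧ x = ν.mass psiOmega}

/-- `χfair_ω(μ) = inf { χmay_ω(ν) : μ ⇝ ν }`. -/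
noncomputable def chiFairOmega (μ : FinDist Tm) : ℝ :=
  sInf {x | ∃ ν, Internal μ ν ∧ x = chiMayOmega ν}

/-! ## Testing contexts, equipollence, extensionality, diamond/box equivalences -/

/-- `Δ(P_CCS) ⊆ 𝒟 ⊆ D(P_RCCS)`, closed under parallel composition, localization
and (finite-domain) renaming. -/
structure IsTestingContext (D : Set (FinDist Tm)) : Prop where
  dirac_ccs : ∀ P : Tm, P.IsCCS → FinDist.dirac P ∈ D
  proc_dist : ∀ μ ∈ D, μ.IsProcDist
  closed_par : ∀ μ ∈ D, ∀ ν ∈ D, μ.parD ν ∈ D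
  closed_loc : ∀ μ ∈ D, ∀ L : Finset Chan, FinDist.locD L μ ∈ D
  closed_rename : ∀ μ ∈ D, ∀ f : Chan → Chan, {a | f a ≠ a}.Finite →
      FinDist.renameD f μ ∈ D

/-- `R` is probabilistically equipollent. -/
def Equipollent (R : FinDist Tm → FinDist Tm → Prop) : Prop :=
  ∀ μ1 μ2, R μ1 μ2 → chiMayL μ1 = chiMayL μ2

/-- `R` is probabilistically strongly equipollent. -/
def StronglyEquipollent (R : FinDist Tm → FinDist Tm → Prop) : Prop :=
  ∀ μ1 μ2, R μ1 μ2 → chiFairL μ1 = chiFairL μ2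

/-- `R` is `𝒟`-extensional. -/
def DExtensional (D : Set (FinDist Tm)) (R : FinDist Tm → FinDist Tm → Prop) : Prop :=
  ∀ μ1 μ2, R μ1 μ2 →
    (∀ ν ∈ D, R (μ1.parD ν) (μ2.parD ν)) ∧
    (∀ L : Finset Chan, R (FinDist.locD L μ1) (FinDist.locD L μ2))

/-- The `𝒟`-diamond equivalence `=◇^𝒟`, the largest probabilistically equipollent
`𝒟`-extensional relation. -/
def DiamondEq (D : Set (FinDist Tm)) (μ1 μ2 : FinDist Tm) : Prop :=
  ∃ R, Equipollent R ∧ DExtensional D R ∧ R μ1 μ2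

/-- The `𝒟`-box equivalence `=□^𝒟`, the largest probabilistically strongly
equipollent `𝒟`-extensional relation. -/
def BoxEq (D : Set (FinDist Tm)) (μ1 μ2 : FinDist Tm) : Prop :=
  ∃ R, StronglyEquipollent R ∧ DExtensional D R ∧ R μ1 μ2

/-! ## Probabilistic strong bisimulation and lifting -/

/-- Lifting of a relation on processes to distributions, matching the decomposition
`ρ1 = Σ_i p_i δ_{A_i}`, `ρ2 = Σ_i p_i δ_{B_i}` with `A_i R B_i`. -/
def RelLift (R : Tm → Tm → Prop) (ρ1 ρ2 : FinDist Tm) : Prop :=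
  ∃ (k : ℕ) (p : Fin (k+1) → ℝ) (A B : Fin (k+1) → Tm),
    (∀ i, 0 ≤ p i) ∧
    (∀ Q, ρ1.toFun Q = ∑ i, if A i = Q then p i else 0) ∧
    (∀ Q, ρ2.toFun Q = ∑ i, if B i = Q then p i else 0) ∧
    (∀ i, R (A i) (B i))

/-- `R` is a probabilistic strong bisimulation. -/
def IsStrongBisim (R : Tm → Tm → Prop) : Prop :=
  ∀ P Q, R P Q →
    (∀ α ρ, Step P α ρ → ∃ ρ', Step Q α ρ' ∧ RelLift R ρ ρ') ∧
    (∀ α ρ, Step Q α ρ → ∃ ρ', Step P α ρ' ∧ RelLift R ρ ρ')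

/-- `∼p`, the largest probabilistic strong bisimulation. -/
def StrongBisim (P Q : Tm) : Prop := ∃ R, IsStrongBisim R ∧ R P Q

/-- Lifting `E†` of an equivalence on processes to distributions: agreement on the
mass of every equivalence class. -/
def EqLift (E : Tm → Tm → Prop) (μ1 μ2 : FinDist Tm) : Prop :=
  ∀ P, μ1.mass {Q | E P Q} = μ2.mass {Q | E P Q}

/-- Single-branch prefix `α.T`. -/
def Tm.prefix1 (α : Act) (T : Tm) : Tm := Tm.sum 0 (fun _ => α) (fun _ => T)

/-- The probabilistic testing context `𝒟 = D(P_RCCS)` of all distributions over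
processes. -/
def fullCtx : Set (FinDist Tm) := {μ | μ.IsProcDist}

/-! ## Expectations of finitely supported distributions -/

namespace FinDist

theorem ext' {α : Type} {μ ν : FinDist α} (h : ∀ a, μ.toFun a = ν.toFun a) : μ = ν := by
  cases μ; cases ν
  have : _ = _ := funext h
  simp only at this
  subst this
  rfl

/-- The support as a finset. -/
noncomputable def supp {α : Type} (μ : FinDist α) : Finset α := μ.finite_support.toFinset

theorem mem_supp {α : Type} (μ : FinDist α) (a : α) : a ∈ μ.supp ↔ μ.toFun a ≠ 0 := by
  simp [supp]

/-- Expectation of a function. -/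
noncomputable def expect {α : Type} (μ : FinDist α) (f : α → ℝ) : ℝ :=
  ∑ a ∈ μ.supp, μ.toFun a * f a

theorem expect_eq_sum {α : Type} (μ : FinDist α) (f : α → ℝ) (s : Finset α)
    (h : ∀ a, μ.toFun a ≠ 0 → a ∈ s) : μ.expect f = ∑ a ∈ s, μ.toFun a * f a := by
  apply Finset.sum_subset
  · intro a ha
    exact h a ((mem_supp μ a).1 ha)
  · intro a _ ha
    have : μ.toFun a = 0 := by
      by_contra h0
      exact ha ((mem_supp μ a).2 h0)
    simp [this]

theorem sum_supp {α : Type} (μ : FinDist α) : ∑ a ∈ μ.supp, μ.toFun a = 1 := by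
  rw [← μ.sum_one, finsum_eq_sum μ.toFun μ.finite_support, supp]

theorem expect_const {α : Type} (μ : FinDist α) (c : ℝ) : μ.expect (fun _ => c) = c := by
  rw [expect, ← Finset.sum_mul, sum_supp, one_mul]

theorem expect_mono {α : Type} (μ : FinDist α) {f g : α → ℝ}
    (h : ∀ a, μ.toFun a ≠ 0 → f a ≤ g a) : μ.expect f ≤ μ.expect g := by
  apply Finset.sum_le_sum
  intro a ha
  exact mul_le_mul_of_nonneg_left (h a ((mem_supp μ a).1 ha)) (μ.nonneg a)

theorem expect_congr {α : Type} (μ : FinDist α) {f g : α → ℝ}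
    (h : ∀ a, μ.toFun a ≠ 0 → f a = g a) : μ.expect f = μ.expect g := by
  apply Finset.sum_congr rfl
  intro a ha
  rw [h a ((mem_supp μ a).1 ha)]

theorem expect_ind {α : Type} (μ : FinDist α) (b : α) :
    μ.expect (fun a => if a = b then 1 else 0) = μ.toFun b := by
  rw [expect_eq_sum μ _ (insert b μ.supp)
    (fun a ha => Finset.mem_insert_of_mem ((mem_supp μ a).2 ha))]
  simp

theorem ext_expect {α : Type} {μ ν : FinDist α} (h : ∀ f, μ.expect f = ν.expect f) : μ = ν := by
  apply ext'
  intro a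
  rw [← expect_ind, ← expect_ind, h]

theorem expect_dirac {α : Type} (P : α) (f : α → ℝ) : (dirac P).expect f = f P := by
  rw [expect_eq_sum _ _ {P}]
  · simp [dirac]
  · intro a ha
    by_contra h
    simp at h
    simp [dirac, h] at ha

theorem map_toFun {α β : Type} (g : α → β) (μ : FinDist α) (b : β) :
    (map g μ).toFun b = ∑ a ∈ μ.supp.filter (fun a => g a = b), μ.toFun a := by
  apply finsum_mem_eq_sum_of_inter_support_eq
  ext a
  simp only [Set.mem_inter_iff, Set.mem_ofPred_eq, Finset.coe_filter, mem_supp,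
    Function.mem_support]
  tauto

theorem expect_map {α β : Type} (g : α → β) (μ : FinDist α) (f : β → ℝ) :
    (map g μ).expect f = μ.expect (fun a => f (g a)) := by
  rw [expect_eq_sum _ _ (μ.supp.image g)]
  · rw [expect, ← Finset.sum_fiberwise_of_maps_to
      (fun a ha => Finset.mem_image_of_mem g ha)]
    apply Finset.sum_congr rfl
    intro b _
    rw [map_toFun, Finset.sum_mul]
    apply Finset.sum_congr rfl
    intro a ha
    rw [(Finset.mem_filter.1 ha).2]
  · intro b hb
    rw [map_toFun] at hb
    obtain ⟨a, ha, _⟩ := Finset.exists_ne_zero_of_sum_ne_zero hb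
    rw [Finset.mem_filter] at ha
    exact Finset.mem_image.2 ⟨a, ha.1, ha.2⟩

theorem expect_prod {α β : Type} (μ : FinDist α) (ν : FinDist β) (f : α × β → ℝ) :
    (prod μ ν).expect f = μ.expect (fun a => ν.expect (fun b => f (a, b))) := by
  rw [expect_eq_sum _ _ (μ.supp ×ˢ ν.supp)]
  · rw [Finset.sum_product]
    unfold expect
    apply Finset.sum_congr rfl
    intro a _
    rw [Finset.mul_sum]
    apply Finset.sum_congr rfl
    intro b _
    simp only [prod]
    ring
  · intro x hx
    have h := mul_ne_zero_iff.mp hx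
    exact Finset.mem_product.2 ⟨(mem_supp _ _).2 h.1, (mem_supp _ _).2 h.2⟩

theorem prod_ne {α β : Type} {μ : FinDist α} {ν : FinDist β} {x : α × β}
    (h : (prod μ ν).toFun x ≠ 0) : μ.toFun x.1 ≠ 0 ∧ ν.toFun x.2 ≠ 0 :=
  mul_ne_zero_iff.mp h

theorem expect_comm {α β : Type} (μ : FinDist α) (ν : FinDist β) (f : α → β → ℝ) :
    μ.expect (fun a => ν.expect (fun b => f a b)) =
      ν.expect (fun b => μ.expect (fun a => f a b)) := by
  unfold expect
  simp only [Finset.mul_sum]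
  rw [Finset.sum_comm]
  apply Finset.sum_congr rfl
  intro b _
  apply Finset.sum_congr rfl
  intro a _
  ring

theorem map_id' {α : Type} (μ : FinDist α) : map (fun a => a) μ = μ := by
  apply ext_expect; intro f; rw [expect_map]

theorem map_map' {α β γ : Type} (g : α → β) (h : β → γ) (μ : FinDist α) :
    map h (map g μ) = map (fun a => h (g a)) μ := by
  apply ext_expect; intro f; simp only [expect_map]

theorem map_dirac {α β : Type} (g : α → β) (a : α) : map g (dirac a) = dirac (g a) := by
  apply ext_expect; intro f; simp only [expect_map, expect_dirac]

theorem map_const {α β : Type} (b : β) (μ : FinDist α) : map (fun _ => b) μ = dirac b := by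
  apply ext_expect; intro f; simp only [expect_map, expect_dirac, expect_const]

theorem expect_parD (μ ν : FinDist Tm) (f : Tm → ℝ) :
    (μ.parD ν).expect f = μ.expect (fun a => ν.expect (fun b => f (.par a b))) := by
  rw [parD, expect_map, expect_prod]

theorem parD_map {α β : Type} (f : α → Tm) (g : β → Tm) (μ : FinDist α) (ν : FinDist β) :
    (map f μ).parD (map g ν) = map (fun x : α × β => Tm.par (f x.1) (g x.2)) (prod μ ν) := by
  apply ext_expect; intro h; simp only [expect_parD, expect_map, expect_prod]

theorem parD_map_swap {α β : Type} (f : α → Tm) (g : β → Tm) (μ : FinDist α) (ν : FinDist β) :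
    (map g ν).parD (map f μ) = map (fun x : α × β => Tm.par (g x.2) (f x.1)) (prod μ ν) := by
  apply ext_expect; intro h
  simp only [expect_parD, expect_map, expect_prod]
  rw [expect_comm]

theorem parD_dirac (P Q : Tm) : (dirac P).parD (dirac Q) = dirac (.par P Q) := by
  apply ext_expect; intro h; simp only [expect_parD, expect_dirac]

theorem locD_dirac (L : Finset Chan) (P : Tm) : locD L (dirac P) = dirac (.loc L P) :=
  map_dirac _ _

/-- Probability of a set as an expectation. -/
theorem mass_eq {α : Type} (μ : FinDist α) (φ : Set α) :
    μ.mass φ = μ.expect (fun a => if a ∈ φ then 1 else 0) := by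
  rw [mass, expect]
  rw [finsum_mem_eq_sum_of_inter_support_eq (t := μ.supp.filter (· ∈ φ)), Finset.sum_filter]
  · apply Finset.sum_congr rfl
    intro a _
    split_ifs <;> simp
  · ext a
    simp only [Set.mem_inter_iff, Finset.coe_filter, mem_supp,
      Function.mem_support, Set.mem_ofPred_eq]
    tauto

/-- Moving mass `m` from `P` along `ρ`. -/
theorem exists_move {α : Type} (μ ρ : FinDist α) (P : α) (m : ℝ) (h0 : 0 ≤ m)
    (h1 : m ≤ μ.toFun P) :
    ∃ ν : FinDist α, ∀ Q, ν.toFun Q = μ.toFun Q + m * (ρ.toFun Q - (if Q = P then 1 else 0)) := by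
  have hsub : Function.support (fun Q => μ.toFun Q + m * (ρ.toFun Q - (if Q = P then 1 else 0)))
      ⊆ ↑(insert P (μ.supp ∪ ρ.supp)) := by
    intro a ha
    by_contra hn
    simp only [Finset.coe_insert, Finset.coe_union, Set.mem_insert_iff, Set.mem_union,
      Finset.mem_coe, mem_supp, not_or, not_not] at hn
    apply ha
    simp [hn.1, hn.2.1, hn.2.2]
  refine ⟨⟨_, ?_, Set.Finite.subset (Finset.finite_toSet _) hsub, ?_⟩, fun Q => rfl⟩
  · intro a
    have := mul_nonneg h0 (ρ.nonneg a)
    have := μ.nonneg a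
    split_ifs with h
    · subst h; linarith
    · linarith
  · rw [finsum_eq_finsetSum_of_support_subset _ hsub, Finset.sum_add_distrib, ← Finset.mul_sum,
      Finset.sum_sub_distrib]
    have e1 := expect_eq_sum μ (fun _ => 1) (insert P (μ.supp ∪ ρ.supp))
      (fun a ha => by simp [mem_supp, ha])
    have e2 := expect_eq_sum ρ (fun _ => 1) (insert P (μ.supp ∪ ρ.supp))
      (fun a ha => by simp [mem_supp, ha])
    rw [expect_const] at e1 e2
    simp only [mul_one] at e1 e2
    rw [← e1, ← e2]
    simp

theorem expect_move {α : Type} {μ ρ ν : FinDist α} {P : α} {m : ℝ}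
    (h : ∀ Q, ν.toFun Q = μ.toFun Q + m * (ρ.toFun Q - (if Q = P then 1 else 0)))
    (f : α → ℝ) : ν.expect f = μ.expect f + m * (ρ.expect f - f P) := by
  set s := insert P (μ.supp ∪ ρ.supp ∪ ν.supp) with hs
  rw [expect_eq_sum ν f s (fun a ha => by simp [hs, mem_supp, ha]),
    expect_eq_sum μ f s (fun a ha => by simp [hs, mem_supp, ha]),
    expect_eq_sum ρ f s (fun a ha => by simp [hs, mem_supp, ha])]
  have hP : f P = ∑ a ∈ s, (if a = P then 1 else 0) * f a := by
    simp [hs]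
  rw [hP, ← Finset.sum_sub_distrib, Finset.mul_sum, ← Finset.sum_add_distrib]
  apply Finset.sum_congr rfl
  intro a _
  rw [h]; ring

end FinDist

open FinDist

/-! ## Values of processes -/

/-- Values achievable by a finite strategy. -/
inductive Val : Tm → ℝ → Prop where
  | zero (P : Tm) : Val P 0
  | one (P : Tm) : P ∈ psiL → Val P 1
  | step (P : Tm) (ρ : FinDist Tm) (f : Tm → ℝ) : Step P .tau ρ →
      (∀ Q, ρ.toFun Q ≠ 0 → Val Q (f Q)) → Val P (ρ.expect f)

theorem Val.le_one {P : Tm} {x : ℝ} (h : Val P x) : x ≤ 1 := by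
  induction h with
  | zero => norm_num
  | one => norm_num
  | step P ρ f _ _ ih => exact (expect_mono ρ ih).trans (expect_const ρ 1).le

/-- The optimal value. -/
noncomputable def VV (P : Tm) : ℝ := sSup {x | Val P x}

theorem Val.le_VV {P : Tm} {x : ℝ} (h : Val P x) : x ≤ VV P :=
  le_csSup ⟨1, fun _ hy => Val.le_one hy⟩ h

theorem VV_le {P : Tm} {c : ℝ} (h : ∀ x, Val P x → x ≤ c) : VV P ≤ c :=
  csSup_le ⟨0, Val.zero P⟩ h

theorem exists_val (P : Tm) (ε : ℝ) (hε : 0 < ε) : ∃ x, Val P x ∧ VV P - ε < x :=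
  exists_lt_of_lt_csSup ⟨0, Val.zero P⟩ (by show VV P - ε < VV P; linarith)

theorem VV_nonneg (P : Tm) : 0 ≤ VV P := (Val.zero P).le_VV

theorem one_le_VV {P : Tm} (h : P ∈ psiL) : 1 ≤ VV P := (Val.one P h).le_VV

theorem expect_VV_le (μ : FinDist Tm) (c : ℝ)
    (h : ∀ f, (∀ Q, Val Q (f Q)) → μ.expect f ≤ c) : μ.expect VV ≤ c := by
  apply le_of_forall_pos_le_add
  intro ε hε
  choose f hf1 hf2 using fun P => exists_val P ε hε
  have h1 := h f hf1
  have h2 : μ.expect VV ≤ μ.expect (fun a => f a + ε) :=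
    expect_mono μ (fun a _ => by linarith [hf2 a])
  have h3 : μ.expect (fun a => f a + ε) = μ.expect f + ε := by
    have := expect_const μ ε
    unfold expect at this ⊢
    rw [← this, ← Finset.sum_add_distrib]
    simp only [this]
    exact Finset.sum_congr rfl (fun a _ => by ring)
  linarith

theorem VV_step {P : Tm} {ρ : FinDist Tm} (h : Step P .tau ρ) : ρ.expect VV ≤ VV P :=
  expect_VV_le ρ _ (fun f hf => (Val.step P ρ f h (fun Q _ => hf Q)).le_VV)

theorem Internal.refl (μ : FinDist Tm) : Internal μ μ := ⟨[], by simp, rfl⟩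

theorem Internal.head {μ μ' ν : FinDist Tm} {p : ℝ} (h : PStep μ .tau p μ') (h' : Internal μ' ν) :
    Internal μ ν := by
  obtain ⟨π, h1, h2⟩ := h'
  refine ⟨(.tau, p) :: π, ?_, μ', h, h2⟩
  intro s hs
  rcases List.mem_cons.1 hs with rfl | hs
  · rfl
  · exact h1 s hs

theorem Internal.ind {M : FinDist Tm → FinDist Tm → Prop} (hr : ∀ μ, M μ μ)
    (hs : ∀ μ p μ' ν, PStep μ .tau p μ' → Internal μ' ν → M μ' ν → M μ ν)
    {μ ν : FinDist Tm} (h : Internal μ ν) : M μ ν := by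
  obtain ⟨π, h1, h2⟩ := h
  induction π generalizing μ with
  | nil => cases h2; exact hr _
  | cons s π ih =>
    obtain ⟨μ', h3, h4⟩ := h2
    have e : s.1 = .tau := h1 s (by simp)
    rw [e] at h3
    have h5 : ∀ s ∈ π, s.1 = Act.tau := fun t ht => h1 t (by simp [ht])
    exact hs _ _ _ _ h3 ⟨π, h5, h4⟩ (ih h5 h4)

theorem Internal.trans {μ ν ξ : FinDist Tm} (h : Internal μ ν) (h' : Internal ν ξ) :
    Internal μ ξ :=
  Internal.ind (M := fun μ ν => Internal ν ξ → Internal μ ξ) (fun _ h => h)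
    (fun _ _ _ _ hs _ ih h => Internal.head hs (ih h)) h h'

theorem Internal.mass_le {μ ν : FinDist Tm} (h : Internal μ ν) : ν.mass psiL ≤ μ.expect VV := by
  refine Internal.ind (M := fun μ ν => ν.mass psiL ≤ μ.expect VV) ?_ ?_ h
  · intro μ
    rw [mass_eq]
    apply expect_mono
    intro a _
    split_ifs with h
    · exact one_le_VV h
    · exact VV_nonneg a
  · intro μ p μ' ν hs _ ih
    refine ih.trans ?_
    obtain ⟨hp, _, P, ρ, hP, hst, hν⟩ := hs
    rw [expect_move hν]
    have := VV_step hst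
    have := mul_nonneg (mul_pos hP hp).le (sub_nonneg.2 this)
    linarith

/-- `P`'s mass can be moved internally to `η`. -/
def Can (P : Tm) (η : FinDist Tm) : Prop :=
  ∀ (μ : FinDist Tm) (m : ℝ), 0 ≤ m → m ≤ μ.toFun P → ∃ ν, Internal μ ν ∧
    ∀ Q, ν.toFun Q = μ.toFun Q + m * (η.toFun Q - (if Q = P then 1 else 0))

theorem Can.refl (P : Tm) : Can P (dirac P) := by
  intro μ m _ _
  exact ⟨μ, Internal.refl μ, fun Q => by simp [dirac]⟩

theorem can_multi (η : Tm → FinDist Tm) (μ : FinDist Tm) (c : Tm → ℝ) (hc0 : ∀ Q, 0 ≤ c Q)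
    (hc : ∀ Q, c Q ≤ μ.toFun Q) (s : Finset Tm) (hs : ∀ Q ∈ s, Can Q (η Q)) :
    ∃ ν, Internal μ ν ∧ ∀ R, ν.toFun R =
      μ.toFun R + ∑ Q ∈ s, c Q * ((η Q).toFun R - (if R = Q then 1 else 0)) := by
  induction s using Finset.induction_on with
  | empty => exact ⟨μ, Internal.refl μ, by simp⟩
  | insert P s hP ih =>
    obtain ⟨ν, h1, h2⟩ := ih (fun Q hQ => hs Q (Finset.mem_insert_of_mem hQ))
    obtain ⟨ν', h3, h4⟩ := hs P (Finset.mem_insert_self _ _) ν (c P) (hc0 P) (by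
      rw [h2]
      have : 0 ≤ ∑ Q ∈ s, c Q * ((η Q).toFun P - (if P = Q then 1 else 0)) := by
        apply Finset.sum_nonneg
        intro Q hQ
        have : P ≠ Q := fun e => hP (e ▸ hQ)
        simp only [this, if_false, sub_zero]
        exact mul_nonneg (hc0 Q) ((η Q).nonneg P)
      linarith [hc P])
    refine ⟨ν', h1.trans h3, fun R => ?_⟩
    rw [h4, h2, Finset.sum_insert hP]
    ring

/-- Monadic bind. -/
theorem exists_bind (ρ : FinDist Tm) (η : Tm → FinDist Tm) :
    ∃ ξ : FinDist Tm, (∀ R, ξ.toFun R = ρ.expect (fun Q => (η Q).toFun R)) ∧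
      ∀ f, ξ.expect f = ρ.expect (fun Q => (η Q).expect f) := by
  have hsub : Function.support (fun R => ρ.expect (fun Q => (η Q).toFun R)) ⊆
      ↑(ρ.supp.biUnion (fun Q => (η Q).supp)) := by
    intro R hR
    obtain ⟨Q, hQ, hne⟩ := Finset.exists_ne_zero_of_sum_ne_zero hR
    simp only [Finset.coe_biUnion, Set.mem_iUnion]
    exact ⟨Q, hQ, (mem_supp _ _).2 (right_ne_zero_of_mul hne)⟩
  have key : ∀ f : Tm → ℝ, ∑ R ∈ ρ.supp.biUnion (fun Q => (η Q).supp),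
      ρ.expect (fun Q => (η Q).toFun R) * f R = ρ.expect (fun Q => (η Q).expect f) := by
    intro f
    unfold expect
    simp only [Finset.sum_mul]
    rw [Finset.sum_comm]
    apply Finset.sum_congr rfl
    intro Q hQ
    have := expect_eq_sum (η Q) f (ρ.supp.biUnion (fun Q => (η Q).supp))
      (fun a ha => Finset.mem_biUnion.2 ⟨Q, hQ, (mem_supp _ _).2 ha⟩)
    unfold expect at this
    rw [this, Finset.mul_sum]
    apply Finset.sum_congr rfl
    intro R _
    ring
  refine ⟨⟨_, ?_, Set.Finite.subset (Finset.finite_toSet _) hsub, ?_⟩, fun R => rfl, ?_⟩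
  · intro R
    exact Finset.sum_nonneg (fun Q _ => mul_nonneg (ρ.nonneg Q) ((η Q).nonneg R))
  · rw [finsum_eq_finsetSum_of_support_subset _ hsub]
    have := key (fun _ => 1)
    simp only [expect_const, mul_one] at this
    exact this
  · intro f
    rw [expect_eq_sum _ f (ρ.supp.biUnion (fun Q => (η Q).supp))]
    · exact key f
    · exact fun a ha => hsub ha

theorem sum_move (ρ : FinDist Tm) (η : Tm → FinDist Tm) (R : Tm) :
    ∑ Q ∈ ρ.supp, ρ.toFun Q * ((η Q).toFun R - (if R = Q then 1 else 0)) =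
      ρ.expect (fun Q => (η Q).toFun R) - ρ.toFun R := by
  rw [← expect_ind ρ R]
  unfold expect
  rw [← Finset.sum_sub_distrib]
  apply Finset.sum_congr rfl
  intro Q _
  simp only [eq_comm (a := R)]
  ring

theorem Can.step {P : Tm} {ρ ξ : FinDist Tm} {η : Tm → FinDist Tm} (hst : Step P .tau ρ)
    (hη : ∀ Q, ρ.toFun Q ≠ 0 → Can Q (η Q))
    (hξ : ∀ R, ξ.toFun R = ρ.expect (fun Q => (η Q).toFun R)) : Can P ξ := by
  intro μ m hm hmP
  rcases hm.eq_or_lt with rfl | hm'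
  · exact ⟨μ, Internal.refl μ, fun Q => by simp⟩
  obtain ⟨ν0, hν0⟩ := exists_move μ ρ P m hm hmP
  have hP : 0 < μ.toFun P := hm'.trans_le hmP
  have hps : PStep μ .tau (m / μ.toFun P) ν0 := by
    refine ⟨div_pos hm' hP, (div_le_one hP).2 hmP, P, ρ, hP, hst, ?_⟩
    rw [mul_div_cancel₀ _ hP.ne']
    exact hν0
  obtain ⟨ν, h1, h2⟩ := can_multi η ν0 (fun Q => m * ρ.toFun Q)
    (fun Q => mul_nonneg hm (ρ.nonneg Q)) (by
      intro Q
      rw [hν0]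
      have := μ.nonneg Q
      split_ifs with h
      · subst h; linarith
      · linarith) ρ.supp (fun Q hQ => hη Q ((mem_supp _ _).1 hQ))
  refine ⟨ν, Internal.head hps h1, fun R => ?_⟩
  have := sum_move ρ η R
  rw [h2, hν0, hξ]
  simp only [mul_assoc, ← Finset.mul_sum]
  rw [this]
  ring

theorem Val.can {P : Tm} {x : ℝ} (h : Val P x) : ∃ η, Can P η ∧ x ≤ η.mass psiL := by
  induction h with
  | zero P =>
    refine ⟨dirac P, Can.refl P, ?_⟩
    rw [mass_eq, expect_dirac]
    split_ifs <;> norm_num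
  | one P h =>
    refine ⟨dirac P, Can.refl P, ?_⟩
    rw [mass_eq, expect_dirac, if_pos h]
  | step P ρ f hst _ ih =>
    have : ∀ Q, ∃ η, ρ.toFun Q ≠ 0 → Can Q η ∧ f Q ≤ η.mass psiL := by
      intro Q
      by_cases h : ρ.toFun Q ≠ 0
      · obtain ⟨η, hη⟩ := ih Q h
        exact ⟨η, fun _ => hη⟩
      · exact ⟨ρ, fun h' => absurd h' h⟩
    choose η hη using this
    obtain ⟨ξ, h1, h2⟩ := exists_bind ρ η
    refine ⟨ξ, Can.step hst (fun Q hQ => (hη Q hQ).1) h1, ?_⟩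
    rw [mass_eq, h2]
    apply expect_mono
    intro Q hQ
    rw [← mass_eq]
    exact (hη Q hQ).2

theorem chiMayL_eq (μ : FinDist Tm) : chiMayL μ = μ.expect VV := by
  apply le_antisymm
  · refine csSup_le (Set.nonempty_of_mem (x := μ.mass psiL) ⟨μ, Internal.refl μ, rfl⟩) ?_
    rintro x ⟨ν, hν, rfl⟩
    exact hν.mass_le
  · apply expect_VV_le
    intro f hf
    choose η hη using fun Q => (hf Q).can
    obtain ⟨ν, h1, h2⟩ := can_multi η μ μ.toFun μ.nonneg (fun Q => le_rfl) μ.supp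
      (fun Q _ => (hη Q).1)
    obtain ⟨ξ, h3, h4⟩ := exists_bind μ η
    have e : ν = ξ := by
      apply ext'
      intro R
      rw [h2, sum_move, h3]
      ring
    have : ν.mass psiL ≤ chiMayL μ := by
      apply le_csSup
      · refine ⟨μ.expect VV, ?_⟩
        rintro x ⟨ν, hν, rfl⟩
        exact hν.mass_le
      · exact ⟨ν, h1, rfl⟩
    refine le_trans ?_ this
    rw [e, mass_eq, h4]
    apply expect_mono
    intro Q _
    rw [← mass_eq]
    exact (hη Q).2

/-! ## Lifting relations to distributions, simulations -/

/-- Lifting of a relation through a common source distribution. -/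
def Lift (R : Tm → Tm → Prop) (μ ν : FinDist Tm) : Prop :=
  ∃ (ι : Type) (κ : FinDist ι) (f g : ι → Tm), μ = κ.map f ∧ ν = κ.map g ∧
    ∀ i, κ.toFun i ≠ 0 → R (f i) (g i)

theorem Lift.refl {R : Tm → Tm → Prop} (h : ∀ P, R P P) (μ : FinDist Tm) : Lift R μ μ :=
  ⟨Tm, μ, fun a => a, fun a => a, (map_id' μ).symm, (map_id' μ).symm, fun i _ => h i⟩

theorem Lift.dirac {R : Tm → Tm → Prop} {P Q : Tm} (h : R P Q) :
    Lift R (FinDist.dirac P) (FinDist.dirac Q) :=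
  ⟨Unit, FinDist.dirac (), fun _ => P, fun _ => Q, (map_const _ _).symm, (map_const _ _).symm,
    fun _ _ => h⟩

theorem Lift.par {R1 R2 R : Tm → Tm → Prop} {μ1 ν1 μ2 ν2 : FinDist Tm}
    (h1 : Lift R1 μ1 ν1) (h2 : Lift R2 μ2 ν2)
    (h : ∀ P Q P' Q', R1 P Q → R2 P' Q' → R (.par P P') (.par Q Q')) :
    Lift R (μ1.parD μ2) (ν1.parD ν2) := by
  obtain ⟨ι, κ, f, g, rfl, rfl, hr⟩ := h1
  obtain ⟨ι', κ', f', g', rfl, rfl, hr'⟩ := h2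
  refine ⟨ι × ι', κ.prod κ', _, _, parD_map _ _ _ _, parD_map _ _ _ _, ?_⟩
  intro i hi
  exact h _ _ _ _ (hr _ (prod_ne hi).1) (hr' _ (prod_ne hi).2)

theorem Lift.loc {R1 R : Tm → Tm → Prop} {μ ν : FinDist Tm} (L : Finset Chan)
    (h1 : Lift R1 μ ν) (h : ∀ P Q, R1 P Q → R (.loc L P) (.loc L Q)) :
    Lift R (locD L μ) (locD L ν) := by
  obtain ⟨ι, κ, f, g, rfl, rfl, hr⟩ := h1
  exact ⟨ι, κ, _, _, map_map' _ _ _, map_map' _ _ _, fun i hi => h _ _ (hr i hi)⟩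

theorem Lift.swap {R : Tm → Tm → Prop} (h : ∀ P Q, R (.par P Q) (.par Q P))
    (μ ν : FinDist Tm) : Lift R (μ.parD ν) (ν.parD μ) := by
  refine ⟨Tm × Tm, μ.prod ν, fun x => .par x.1 x.2, fun x => .par x.2 x.1, ?_, ?_,
    fun i _ => h _ _⟩
  · rfl
  · have := parD_map_swap (fun a => a) (fun a => a) μ ν
    rwa [map_id', map_id'] at this

/-- Generic simulation principle for values. -/
theorem VV_sim {R : Tm → Tm → Prop} (hpsi : ∀ P Q, R P Q → P ∈ psiL → 1 ≤ VV Q)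
    (htau : ∀ P Q ρ, R P Q → Step P .tau ρ → ∃ ρ', Lift R ρ ρ' ∧ ρ'.expect VV ≤ VV Q)
    {P Q : Tm} (h : R P Q) : VV P ≤ VV Q := by
  apply VV_le
  intro x hx
  induction hx generalizing Q with
  | zero P => exact VV_nonneg Q
  | one P hP => exact hpsi _ _ h hP
  | step P ρ f hst _ ih =>
    obtain ⟨ρ', ⟨ι, κ, a, b, rfl, rfl, hr⟩, hle⟩ := htau _ _ _ h hst
    refine le_trans ?_ hle
    rw [expect_map, expect_map]
    apply expect_mono
    intro i hi
    apply ih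
    · have : 0 < (κ.map a).toFun (a i) := by
        rw [map_toFun]
        refine lt_of_lt_of_le ((κ.nonneg i).lt_of_ne' hi) ?_
        apply Finset.single_le_sum (f := κ.toFun) (fun j _ => κ.nonneg j)
        simp [mem_supp, hi]
      exact this.ne'
    · exact hr i hi

/-- Strong simulations preserve values. -/
theorem VV_strong {R : Tm → Tm → Prop}
    (hs : ∀ P Q α ρ, R P Q → Step P α ρ → ∃ ρ', Step Q α ρ' ∧ Lift R ρ ρ')
    {P Q : Tm} (h : R P Q) : VV P ≤ VV Q := by
  refine VV_sim ?_ ?_ h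
  · rintro P Q h ⟨α, ρ, hα, hst⟩
    obtain ⟨ρ', h1, _⟩ := hs _ _ _ _ h hst
    exact one_le_VV ⟨α, ρ', hα, h1⟩
  · intro P Q ρ h hst
    obtain ⟨ρ', h1, h2⟩ := hs _ _ _ _ h hst
    exact ⟨ρ', h2, VV_step h1⟩

/-- Structural relation: commutativity and folding. -/
inductive SC : Tm → Tm → Prop where
  | refl (P) : SC P P
  | swap (P Q) : SC (.par P Q) (.par Q P)
  | fold (G) : SC (Tm.subst (.fix G) 0 G) (.fix G)
  | par {P P' Q Q'} : SC P P' → SC Q Q' → SC (.par P Q) (.par P' Q')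
  | loc {P P'} (L) : SC P P' → SC (.loc L P) (.loc L P')

theorem Act.Comp.symm {a b : Act} (h : Act.Comp a b) : Act.Comp b a := by
  obtain ⟨c, h | h⟩ := h
  · exact ⟨c, Or.inr ⟨h.2, h.1⟩⟩
  · exact ⟨c, Or.inl ⟨h.2, h.1⟩⟩

theorem SC.sim {P Q : Tm} {α : Act} {ρ : FinDist Tm} (h : SC P Q) (hst : Step P α ρ) :
    ∃ ρ', Step Q α ρ' ∧ Lift SC ρ ρ' := by
  induction h generalizing α ρ with
  | refl P => exact ⟨ρ, hst, Lift.refl SC.refl ρ⟩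
  | swap P Q =>
    cases hst with
    | parL _ h => exact ⟨_, Step.parR _ h, Lift.swap SC.swap _ _⟩
    | parR _ h => exact ⟨_, Step.parL _ h, Lift.swap SC.swap _ _⟩
    | comm hc h1 h2 => exact ⟨_, Step.comm hc.symm h2 h1, Lift.swap SC.swap _ _⟩
  | fold G => exact ⟨ρ, Step.fixp hst, Lift.refl SC.refl ρ⟩
  | par hP hQ ih1 ih2 =>
    cases hst with
    | parL _ h =>
      obtain ⟨ρ', h1, h2⟩ := ih1 h
      exact ⟨_, Step.parL _ h1, h2.par (Lift.dirac hQ) (fun _ _ _ _ => SC.par)⟩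
    | parR _ h =>
      obtain ⟨ρ', h1, h2⟩ := ih2 h
      exact ⟨_, Step.parR _ h1, (Lift.dirac hP).par h2 (fun _ _ _ _ => SC.par)⟩
    | comm hc h h' =>
      obtain ⟨ρ1, h1, h2⟩ := ih1 h
      obtain ⟨ρ2, h3, h4⟩ := ih2 h'
      exact ⟨_, Step.comm hc h1 h3, h2.par h4 (fun _ _ _ _ => SC.par)⟩
  | loc L hP ih =>
    cases hst with
    | loc _ h ha =>
      obtain ⟨ρ', h1, h2⟩ := ih h
      exact ⟨_, Step.loc L h1 ha, h2.loc L (fun _ _ => SC.loc L)⟩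

/-- Evaluation contexts. -/
inductive Ctx : (Tm → Tm) → Prop where
  | hole : Ctx (fun P => P)
  | parR {C} (R : Tm) : R.IsProc → Ctx C → Ctx (fun P => C (.par P R))
  | parL {C} (R : Tm) : R.IsProc → Ctx C → Ctx (fun P => C (.par R P))
  | loc {C} (L) : Ctx C → Ctx (fun P => C (.loc L P))

/-- The contextual preorder. -/
def Le (P Q : Tm) : Prop := ∀ C, Ctx C → VV (C P) ≤ VV (C Q)

theorem Le.refl (P : Tm) : Le P P := fun _ _ => le_rfl

theorem Le.trans {P Q R : Tm} (h : Le P Q) (h' : Le Q R) : Le P R :=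
  fun C hC => (h C hC).trans (h' C hC)

theorem Le.VV_le {P Q : Tm} (h : Le P Q) : VV P ≤ VV Q := h _ Ctx.hole

theorem Le.parR {P Q R : Tm} (h : Le P Q) (hR : R.IsProc) : Le (.par P R) (.par Q R) :=
  fun _ hC => h _ (Ctx.parR R hR hC)

theorem Le.parL {P Q R : Tm} (h : Le P Q) (hR : R.IsProc) : Le (.par R P) (.par R Q) :=
  fun _ hC => h _ (Ctx.parL R hR hC)

theorem Le.loc {P Q : Tm} (h : Le P Q) (L : Finset Chan) : Le (.loc L P) (.loc L Q) :=
  fun _ hC => h _ (Ctx.loc L hC)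

theorem SC.le {P Q : Tm} (h : SC P Q) : Le P Q := by
  intro C hC
  refine VV_strong (fun _ _ _ _ => SC.sim) ?_
  induction hC generalizing P Q with
  | hole => exact h
  | parR R _ _ ih => exact ih (SC.par h (SC.refl R))
  | parL R _ _ ih => exact ih (SC.par (SC.refl R) h)
  | loc L _ ih => exact ih (SC.loc L h)

theorem Le.of_tau {P Q : Tm} (h : Step Q .tau (dirac P)) : Le P Q := by
  intro C hC
  have : Step (C Q) .tau (dirac (C P)) := by
    induction hC generalizing P Q with
    | hole => exact h
    | parR R _ _ ih =>
      apply ih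
      rw [← parD_dirac]
      exact Step.parL R h
    | parL R _ _ ih =>
      apply ih
      rw [← parD_dirac]
      exact Step.parR R h
    | loc L _ ih =>
      apply ih
      rw [← locD_dirac]
      exact Step.loc L h trivial
  have := VV_step this
  rwa [expect_dirac] at this

/-! ## Relation with the diamond equivalence -/

theorem diamond_of_le {P Q : Tm} (h1 : Le P Q) (h2 : Le Q P) :
    DiamondEq fullCtx (dirac P) (dirac Q) := by
  refine ⟨Lift (fun P Q => Le P Q ∧ Le Q P), ?_, ?_, Lift.dirac ⟨h1, h2⟩⟩
  · rintro μ1 μ2 ⟨ι, κ, f, g, rfl, rfl, hr⟩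
    rw [chiMayL_eq, chiMayL_eq, expect_map, expect_map]
    exact expect_congr κ (fun i hi => le_antisymm (hr i hi).1.VV_le (hr i hi).2.VV_le)
  · intro μ1 μ2 h
    refine ⟨fun ν hν => ?_, fun L => h.loc L (fun _ _ h => ⟨h.1.loc L, h.2.loc L⟩)⟩
    have hl : Lift (fun P Q => P = Q ∧ P.IsProc) ν ν :=
      ⟨Tm, ν, fun a => a, fun a => a, (map_id' ν).symm, (map_id' ν).symm,
        fun i hi => ⟨rfl, hν i hi⟩⟩
    refine h.par hl ?_
    rintro P Q R _ h ⟨rfl, hR⟩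
    exact ⟨h.1.parR hR, h.2.parR hR⟩

theorem DiamondEq.trans' {D : Set (FinDist Tm)} {μ ν ξ : FinDist Tm} (h : DiamondEq D μ ν)
    (h' : DiamondEq D ν ξ) : DiamondEq D μ ξ := by
  obtain ⟨R, h1, h2, h3⟩ := h
  obtain ⟨R', h1', h2', h3'⟩ := h'
  refine ⟨fun a c => ∃ b, R a b ∧ R' b c, ?_, ?_, ν, h3, h3'⟩
  · rintro a c ⟨b, hab, hbc⟩
    exact (h1 _ _ hab).trans (h1' _ _ hbc)
  · rintro a c ⟨b, hab, hbc⟩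
    exact ⟨fun θ hθ => ⟨_, (h2 _ _ hab).1 θ hθ, (h2' _ _ hbc).1 θ hθ⟩,
      fun L => ⟨_, (h2 _ _ hab).2 L, (h2' _ _ hbc).2 L⟩⟩

theorem diamond_ext {D : Set (FinDist Tm)} {μ ν : FinDist Tm} (h : DiamondEq D μ ν) :
    (∀ θ ∈ D, DiamondEq D (μ.parD θ) (ν.parD θ)) ∧
      ∀ L, DiamondEq D (locD L μ) (locD L ν) := by
  obtain ⟨R, h1, h2, h3⟩ := h
  exact ⟨fun θ hθ => ⟨R, h1, h2, (h2 _ _ h3).1 θ hθ⟩, fun L => ⟨R, h1, h2, (h2 _ _ h3).2 L⟩⟩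

theorem dirac_proc {P : Tm} (h : P.IsProc) : dirac P ∈ fullCtx := by
  intro Q hQ
  by_cases e : Q = P
  · rwa [e]
  · simp [dirac, e] at hQ

theorem diamond_swap (P Q : Tm) : DiamondEq fullCtx (dirac (.par P Q)) (dirac (.par Q P)) :=
  diamond_of_le (SC.swap P Q).le (SC.swap Q P).le

theorem diamond_VV {P Q : Tm} (h : DiamondEq fullCtx (dirac P) (dirac Q)) {C : Tm → Tm}
    (hC : Ctx C) : VV (C P) = VV (C Q) := by
  induction hC generalizing P Q with
  | hole =>
    obtain ⟨R, h1, h2, h3⟩ := h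
    have := h1 _ _ h3
    rwa [chiMayL_eq, chiMayL_eq, expect_dirac, expect_dirac] at this
  | parR R hR _ ih =>
    apply ih
    have := (diamond_ext h).1 _ (dirac_proc hR)
    rwa [parD_dirac, parD_dirac] at this
  | parL R hR _ ih =>
    apply ih
    have := (diamond_ext h).1 _ (dirac_proc hR)
    rw [parD_dirac, parD_dirac] at this
    exact ((diamond_swap _ _).trans' this).trans' (diamond_swap _ _)
  | loc L _ ih =>
    apply ih
    have := (diamond_ext h).2 L
    rwa [locD_dirac, locD_dirac] at this

/-! ## Substitution -/

theorem subst_closed {T : Tm} (P : Tm) {n m : ℕ} (h : Tm.ClosedAt n T) (hm : n ≤ m) :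
    Tm.subst P m T = T := by
  induction T generalizing n m with
  | nil => rfl
  | var k =>
    have : k < n := h
    simp only [Tm.subst]
    rw [if_neg (by omega)]
  | sum k a c ih => simp only [Tm.subst]; congr; funext i; exact ih i (h i) hm
  | oplus k a c ih => simp only [Tm.subst]; congr; funext i; exact ih i (h i) hm
  | par S T ih1 ih2 => simp only [Tm.subst]; rw [ih1 h.1 hm, ih2 h.2 hm]
  | loc L T ih => simp only [Tm.subst]; rw [ih h hm]
  | fix T ih => simp only [Tm.subst]; rw [ih h (Nat.succ_le_succ hm)]

theorem closed_mono {T : Tm} {n m : ℕ} (h : Tm.ClosedAt n T) (hm : n ≤ m) :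
    Tm.ClosedAt m T := by
  induction T generalizing n m with
  | nil => trivial
  | var k => exact lt_of_lt_of_le (show k < n from h) hm
  | sum k a c ih => exact fun i => ih i (h i) hm
  | oplus k a c ih => exact fun i => ih i (h i) hm
  | par S T ih1 ih2 => exact ⟨ih1 h.1 hm, ih2 h.2 hm⟩
  | loc L T ih => exact ih (n := n) h hm
  | fix T ih => exact ih (n := n + 1) h (Nat.succ_le_succ hm)

theorem closed_subst {T P : Tm} {n : ℕ} (h : Tm.ClosedAt (n + 1) T) (hP : Tm.ClosedAt 0 P) :
    Tm.ClosedAt n (Tm.subst P n T) := by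
  induction T generalizing n with
  | nil => trivial
  | var k =>
    have : k < n + 1 := h
    simp only [Tm.subst]
    split_ifs with e
    · exact closed_mono hP (Nat.zero_le n)
    · show k < n
      omega
  | sum k a c ih => exact fun i => ih i (h i)
  | oplus k a c ih => exact fun i => ih i (h i)
  | par S T ih1 ih2 => exact ⟨ih1 h.1, ih2 h.2⟩
  | loc L T ih => exact ih (n := n) h
  | fix T ih => exact ih (n := n + 1) h

theorem noOmega_subst {T P : Tm} {n : ℕ} (h : T.NoOmega) (hP : P.NoOmega) :
    (Tm.subst P n T).NoOmega := by
  induction T generalizing n with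
  | nil => trivial
  | var k =>
    simp only [Tm.subst]
    split_ifs
    · exact hP
    · trivial
  | sum k a c ih => exact ⟨h.1, fun i => ih i (h.2 i)⟩
  | oplus k a c ih => exact fun i => ih i (h i)
  | par S T ih1 ih2 => exact ⟨ih1 h.1, ih2 h.2⟩
  | loc L T ih => exact ih (n := n) h
  | fix T ih => exact ih (n := n + 1) h

theorem proc_subst {T P : Tm} (h1 : Tm.ClosedAt 1 T) (h2 : T.NoOmega) (hP : P.IsProc) :
    (Tm.subst P 0 T).IsProc := ⟨closed_subst h1 hP.1, noOmega_subst h2 hP.2⟩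

theorem proc_unfold {G : Tm} (h : (Tm.fix G).IsProc) : (Tm.subst (.fix G) 0 G).IsProc :=
  proc_subst h.1 h.2 h

theorem proc_par {P Q : Tm} : (Tm.par P Q).IsProc ↔ P.IsProc ∧ Q.IsProc := by
  constructor
  · rintro ⟨⟨a, b⟩, c, d⟩
    exact ⟨⟨a, c⟩, b, d⟩
  · rintro ⟨⟨a, c⟩, b, d⟩
    exact ⟨⟨a, b⟩, c, d⟩

/-! ## Replacing `fix S` by `B` -/

/-- `Repl S B P Q`: `Q` is obtained from `P` by replacing occurrences of `fix S` by `B`. -/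
inductive Repl (S B : Tm) : Tm → Tm → Prop where
  | leaf : Repl S B (.fix S) B
  | nil : Repl S B .nil .nil
  | var (n) : Repl S B (.var n) (.var n)
  | sum (k a c c') : (∀ i, Repl S B (c i) (c' i)) → Repl S B (.sum k a c) (.sum k a c')
  | oplus (k w c c') : (∀ i, Repl S B (c i) (c' i)) → Repl S B (.oplus k w c) (.oplus k w c')
  | par {P P' Q Q'} : Repl S B P P' → Repl S B Q Q' → Repl S B (.par P Q) (.par P' Q')
  | loc {P P'} (L) : Repl S B P P' → Repl S B (.loc L P) (.loc L P')
  | fix {P P'} : Repl S B P P' → Repl S B (.fix P) (.fix P')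

theorem Repl.refl (S B P : Tm) : Repl S B P P := by
  induction P with
  | nil => exact .nil
  | var n => exact .var n
  | sum k a c ih => exact .sum _ _ _ _ ih
  | oplus k a c ih => exact .oplus _ _ _ _ ih
  | par _ _ h1 h2 => exact .par h1 h2
  | loc L _ h => exact .loc L h
  | fix _ h => exact .fix h

theorem Repl.subst {S B P P' G G' : Tm} (hS : Tm.ClosedAt 1 S) (hB : Tm.ClosedAt 0 B)
    (hP : Repl S B P P') (hG : Repl S B G G') (n : ℕ) :
    Repl S B (Tm.subst P n G) (Tm.subst P' n G') := by
  induction hG generalizing n with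
  | leaf =>
    rw [subst_closed (T := .fix S) P (n := 0) hS (Nat.zero_le n),
      subst_closed P' hB (Nat.zero_le n)]
    exact .leaf
  | nil => exact .nil
  | var k =>
    simp only [Tm.subst]
    split_ifs
    · exact hP
    · exact .var k
  | sum k a c c' _ ih => exact .sum _ _ _ _ (fun i => ih i n)
  | oplus k a c c' _ ih => exact .oplus _ _ _ _ (fun i => ih i n)
  | par _ _ h1 h2 => exact .par (h1 n) (h2 n)
  | loc L _ h => exact .loc L (h n)
  | fix _ h => exact .fix (h (n + 1))

/-- Replacement, where the target is a process. -/
def ReplP (S B P Q : Tm) : Prop := Repl S B P Q ∧ Q.IsProc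

/-- A step to `ρ` is matched by `Q`, up to the contextual preorder. -/
def Match (S B : Tm) (α : Act) (Q : Tm) (ρ : FinDist Tm) : Prop :=
  (∃ Q' ρ', Q'.IsProc ∧ Le Q' Q ∧ Step Q' α ρ' ∧ Lift (ReplP S B) ρ ρ') ∨
    (α = .tau ∧ ∃ M N, ρ = dirac M ∧ ReplP S B M N ∧ Le N Q)

theorem Match.mono {S B : Tm} {α : Act} {Q Q2 : Tm} {ρ : FinDist Tm} (h : Match S B α Q ρ)
    (hle : Le Q Q2) : Match S B α Q2 ρ := by
  rcases h with ⟨Q', ρ', h1, h2, h3, h4⟩ | ⟨h1, M, N, h2, h3, h4⟩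
  · exact Or.inl ⟨Q', ρ', h1, h2.trans hle, h3, h4⟩
  · exact Or.inr ⟨h1, M, N, h2, h3, h4.trans hle⟩

/-- Distribution given by the weights of a probabilistic choice. -/
theorem exists_weights {k : ℕ} {w : Fin (k+1) → ℝ} {c : Fin (k+1) → Tm} {ρ : FinDist Tm}
    (hw : ∀ i, 0 < w i ∧ w i < 1)
    (hρ : ∀ Q, ρ.toFun Q = ∑ i, if c i = Q then w i else 0) :
    ∃ κ : FinDist (Fin (k+1)),
      ∀ (c' : Fin (k+1) → Tm) Q, (κ.map c').toFun Q = ∑ i, if c' i = Q then w i else 0 := by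
  have hsum : ∑ i, w i = 1 := by
    have h1 := expect_eq_sum ρ (fun _ => 1) (Finset.univ.image c) (by
      intro a ha
      rw [hρ] at ha
      obtain ⟨i, _, hi⟩ := Finset.exists_ne_zero_of_sum_ne_zero ha
      have : c i = a := by
        by_contra h
        simp [h] at hi
      exact Finset.mem_image.2 ⟨i, Finset.mem_univ i, this⟩)
    rw [expect_const] at h1
    simp only [mul_one, hρ] at h1
    rw [Finset.sum_comm] at h1
    rw [h1]
    apply Finset.sum_congr rfl
    intro i _
    rw [Finset.sum_ite_eq]
    simp
  refine ⟨⟨w, fun i => (hw i).1.le, Set.toFinite _, ?_⟩, ?_⟩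
  · rw [finsum_eq_sum_of_fintype, hsum]
  · intro c' Q
    rw [map_toFun, ← Finset.sum_filter]
    apply Finset.sum_congr _ (fun _ _ => rfl)
    ext i
    simp [mem_supp, (hw i).1.ne']

theorem Repl.step {S B : Tm} (hS : Tm.ClosedAt 1 S) (hSo : S.NoOmega) (hB : B.IsProc)
    (hle : Le (Tm.subst B 0 S) B ∨
      ∃ S0, S = Tm.prefix1 .tau S0 ∧ Le (Tm.subst B 0 S0) B)
    {P Q : Tm} {α : Act} {ρ : FinDist Tm} (hst : Step P α ρ) (hr : Repl S B P Q)
    (hQ : Q.IsProc) : Match S B α Q ρ := by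
  induction hst generalizing Q with
  | choice acts conts i =>
    cases hr with
    | sum _ _ _ c' h =>
      exact Or.inl ⟨_, _, hQ, Le.refl _, Step.choice acts c' i,
        Lift.dirac ⟨h i, hQ.1 i, hQ.2.2 i⟩⟩
  | oplus w conts ρ hw hρ =>
    cases hr with
    | oplus _ _ _ c' h =>
      obtain ⟨κ, hκ⟩ := exists_weights hw hρ
      refine Or.inl ⟨_, κ.map c', hQ, Le.refl _, Step.oplus w c' _ hw (hκ c'),
        ⟨_, κ, conts, c', ?_, rfl, fun i _ => ⟨h i, hQ.1 i, hQ.2 i⟩⟩⟩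
      apply ext'
      intro R
      rw [hρ, hκ]
  | parL T0 _ ih =>
    cases hr with
    | par h1 h2 =>
      rw [proc_par] at hQ
      rcases ih h1 hQ.1 with ⟨Q', ρ', a1, a2, a3, a4⟩ | ⟨a1, M, N, rfl, a3, a4⟩
      · exact Or.inl ⟨_, _, proc_par.2 ⟨a1, hQ.2⟩, a2.parR hQ.2, Step.parL _ a3,
          a4.par (Lift.dirac (R := ReplP S B) ⟨h2, hQ.2⟩)
            (fun _ _ _ _ x y => ⟨.par x.1 y.1, proc_par.2 ⟨x.2, y.2⟩⟩)⟩
      · exact Or.inr ⟨a1, _, _, parD_dirac _ _, ⟨.par a3.1 h2, proc_par.2 ⟨a3.2, hQ.2⟩⟩,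
          a4.parR hQ.2⟩
  | parR S0 _ ih =>
    cases hr with
    | par h1 h2 =>
      rw [proc_par] at hQ
      rcases ih h2 hQ.2 with ⟨Q', ρ', a1, a2, a3, a4⟩ | ⟨a1, M, N, rfl, a3, a4⟩
      · exact Or.inl ⟨_, _, proc_par.2 ⟨hQ.1, a1⟩, a2.parL hQ.1, Step.parR _ a3,
          (Lift.dirac (R := ReplP S B) ⟨h1, hQ.1⟩).par a4
            (fun _ _ _ _ x y => ⟨.par x.1 y.1, proc_par.2 ⟨x.2, y.2⟩⟩)⟩
      · exact Or.inr ⟨a1, _, _, parD_dirac _ _, ⟨.par h1 a3.1, proc_par.2 ⟨hQ.1, a3.2⟩⟩,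
          a4.parL hQ.1⟩
  | comm hc _ _ ih1 ih2 =>
    cases hr with
    | par h1 h2 =>
      rw [proc_par] at hQ
      rcases ih1 h1 hQ.1 with ⟨Q', ρ', a1, a2, a3, a4⟩ | ⟨rfl, _⟩
      · rcases ih2 h2 hQ.2 with ⟨Q2, ρ2, b1, b2, b3, b4⟩ | ⟨rfl, _⟩
        · exact Or.inl ⟨_, _, proc_par.2 ⟨a1, b1⟩, (a2.parR b1).trans (b2.parL hQ.1),
            Step.comm hc a3 b3,
            a4.par b4 (fun _ _ _ _ x y => ⟨.par x.1 y.1, proc_par.2 ⟨x.2, y.2⟩⟩)⟩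
        · obtain ⟨c, h | h⟩ := hc <;> simp at h
      · obtain ⟨c, h | h⟩ := hc <;> simp at h
  | loc L _ hal ih =>
    cases hr with
    | loc _ h1 =>
      have hQ' : Tm.IsProc _ := ⟨hQ.1, hQ.2⟩
      rcases ih h1 ⟨hQ.1, hQ.2⟩ with ⟨Q', ρ', a1, a2, a3, a4⟩ | ⟨a1, M, N, rfl, a3, a4⟩
      · exact Or.inl ⟨.loc L Q', _, ⟨a1.1, a1.2⟩, a2.loc L, Step.loc L a3 hal,
          a4.loc L (fun _ _ x => ⟨.loc L x.1, x.2.1, x.2.2⟩)⟩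
      · exact Or.inr ⟨a1, _, _, locD_dirac _ _, ⟨.loc L a3.1, a3.2.1, a3.2.2⟩, a4.loc L⟩
  | fixp hst' ih =>
    cases hr with
    | leaf =>
      rcases hle with hle | ⟨S0, rfl, hle⟩
      · exact (ih (Repl.subst hS hB.1 .leaf (Repl.refl _ _ _) 0)
          (proc_subst hS hSo hB)).mono hle
      · have hS0 : Tm.ClosedAt 1 S0 := hS 0
        have hS0o : S0.NoOmega := hSo.2 0
        generalize hA : Tm.fix (Tm.prefix1 .tau S0) = A at hst'
        simp only [Tm.prefix1, Tm.subst] at hst'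
        cases hst' with
        | choice _ _ i =>
          refine Or.inr ⟨rfl, _, _, rfl, ⟨?_, proc_subst hS0 hS0o hB⟩, hle⟩
          refine Repl.subst hS hB.1 ?_ (Repl.refl _ _ _) 0
          rw [← hA]
          exact .leaf
    | fix h1 =>
      exact (ih (Repl.subst hS hB.1 (.fix h1) h1 0) (proc_unfold hQ)).mono (SC.fold _).le

/-- Park induction. -/
theorem park {S B : Tm} (hS : Tm.ClosedAt 1 S) (hSo : S.NoOmega) (hB : B.IsProc)
    (hle : Le (Tm.subst B 0 S) B ∨
      ∃ S0, S = Tm.prefix1 .tau S0 ∧ Le (Tm.subst B 0 S0) B) : Le (.fix S) B := by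
  intro C hC
  have key : ∀ P Q, ReplP S B P Q → ReplP S B (C P) (C Q) := by
    induction hC with
    | hole => exact fun _ _ h => h
    | parR R hR _ ih =>
      exact fun _ _ h => ih _ _ ⟨.par h.1 (Repl.refl _ _ _), proc_par.2 ⟨h.2, hR⟩⟩
    | parL R hR _ ih =>
      exact fun _ _ h => ih _ _ ⟨.par (Repl.refl _ _ _) h.1, proc_par.2 ⟨hR, h.2⟩⟩
    | loc L _ ih => exact fun _ _ h => ih _ _ ⟨.loc L h.1, h.2.1, h.2.2⟩
  refine VV_sim (R := ReplP S B) ?_ ?_ (key _ _ ⟨.leaf, hB⟩)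
  · rintro P Q ⟨hr, hQ⟩ ⟨α, ρ, hα, hst⟩
    rcases Repl.step hS hSo hB hle hst hr hQ with ⟨Q', ρ', a1, a2, a3, a4⟩ | ⟨rfl, _⟩
    · exact (one_le_VV ⟨α, ρ', hα, a3⟩).trans a2.VV_le
    · exact absurd hα id
  · rintro P Q ρ ⟨hr, hQ⟩ hst
    rcases Repl.step hS hSo hB hle hst hr hQ with ⟨Q', ρ', a1, a2, a3, a4⟩ | ⟨_, M, N, rfl, a3, a4⟩
    · exact ⟨ρ', a4, (VV_step a3).trans a2.VV_le⟩
    · exact ⟨dirac N, Lift.dirac a3, by rw [expect_dirac]; exact a4.VV_le⟩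

theorem le_fix_tau (T : Tm) :
    Le (Tm.subst (.fix (Tm.prefix1 .tau T)) 0 T) (.fix (Tm.prefix1 .tau T)) := by
  apply Le.of_tau
  apply Step.fixp
  exact Step.choice (k := 0) (fun _ => .tau)
    (fun _ => Tm.subst (.fix (Tm.prefix1 .tau T)) 0 T) 0

theorem prefix_closed {T : Tm} {n : ℕ} (h : Tm.ClosedAt n T) :
    Tm.ClosedAt n (Tm.prefix1 .tau T) := fun _ => h

theorem prefix_noOmega {T : Tm} (h : T.NoOmega) : (Tm.prefix1 .tau T).NoOmega :=
  ⟨fun _ => by simp, fun _ => h⟩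

/-- Lemma "add τ". Let `S, T` be RCCS terms with at most one
free variable `X` and let `=◇^p` be the diamond equivalence for `𝒟 = D(P_RCCS)`.
(1) If `δ_{S{P/X}} =◇^p δ_{T{P/X}}` for every process `P`, then
    `δ_{μX.τ.S} =◇^p δ_{μX.τ.T}`.
(2) `δ_{μX.T} =◇^p δ_{μX.τ.T}`. -/
theorem add_tau
    (S T : Tm) (hS1 : Tm.ClosedAt 1 S) (hT1 : Tm.ClosedAt 1 T)
    (hS2 : S.NoOmega) (hT2 : T.NoOmega) :
    ((∀ P : Tm, P.IsProc →
        DiamondEq fullCtx (FinDist.dirac (Tm.subst P 0 S))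
          (FinDist.dirac (Tm.subst P 0 T))) →
      DiamondEq fullCtx (FinDist.dirac (.fix (Tm.prefix1 .tau S)))
        (FinDist.dirac (.fix (Tm.prefix1 .tau T)))) ∧
    DiamondEq fullCtx (FinDist.dirac (.fix T))
      (FinDist.dirac (.fix (Tm.prefix1 .tau T))) := by
  have hpS : (Tm.fix (Tm.prefix1 .tau S)).IsProc := ⟨prefix_closed hS1, prefix_noOmega hS2⟩
  have hpT : (Tm.fix (Tm.prefix1 .tau T)).IsProc := ⟨prefix_closed hT1, prefix_noOmega hT2⟩
  have hpT' : (Tm.fix T).IsProc := ⟨hT1, hT2⟩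
  refine ⟨fun h => diamond_of_le ?_ ?_, diamond_of_le ?_ ?_⟩
  · refine park (prefix_closed hS1) (prefix_noOmega hS2) hpT (Or.inr ⟨S, rfl, ?_⟩)
    exact Le.trans (fun C hC => (diamond_VV (h _ hpT) hC).le) (le_fix_tau T)
  · refine park (prefix_closed hT1) (prefix_noOmega hT2) hpS (Or.inr ⟨T, rfl, ?_⟩)
    exact Le.trans (fun C hC => (diamond_VV (h _ hpS) hC).ge) (le_fix_tau S)
  · exact park hT1 hT2 hpT (Or.inl (le_fix_tau T))
  · exact park (prefix_closed hT1) (prefix_noOmega hT2) hpT' (Or.inr ⟨T, rfl, (SC.fold T).le⟩)
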